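/- Assume K¹,K² are bounded kernels: sup_{x∈T} K^i(x,x) ≤ κ_i² for i=1,2. Then for all i,j ∈ {1,2} and all X ∈ T^m, ‖R_{ij,X}‖_{HS(H_{K^j},H_{K^i})} ≤ κ_i κ_j. Moreover, if X = (x_1,…,x_m) is sampled independently from (T,ν), then for every 0 < δ < 1, with probability at least 1−δ, both ‖R_{ij,X} − R_{ij}‖_{HS(H_{K^j},H_{K^i})} ≤ κ_i κ_j [2log(2/δ)/m + √(2log(2/δ)/m)] and ‖R_{ij,X}* R_{ij,X} − R_{ij}* R_{ij}‖_{tr(H_{K^j})} ≤ 2 κ_i² κ_j² [2log(2/δ)/m + √(2log(2/δ)/m)]. In particular ‖L_{K^i,X}‖_{HS(H_{K^i})} ≤ κ_i² and, with probability at least 1−δ, ‖L_{K^i,X} − L_{K^i}‖_{HS(H_{K^i})} ≤ κ_i² (2log(2/δ)/m + √(2log(2/δ)/m)). -/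

import Mathlib

/- STATEMENT 2: bounded kernels `sup_x K^i(x,x) ≤ κ_i²`.  With the RKHS/feature-map encoding
(`H i`, `Φ i`, Hilbert bases `e i`), `R i j = ∫ K^i_t ⊗ K^j_t dν(t)` and empirical versions
`RX i j X = (1/m) Σ_k K^i_{X k} ⊗ K^j_{X k}` (note `RX i i X = L_{K^i,X}`, `R i i = L_{K^i}`):
(1) `‖RX i j X‖_HS ≤ κ_i κ_j` for all `X ∈ T^m`;
(2) for `X` i.i.d. from `ν` and `0 < δ < 1`, with probability at least `1−δ`, both
    `‖RX i j X − R i j‖_HS ≤ κ_i κ_j [2log(2/δ)/m + √(2log(2/δ)/m)]` and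
    `‖(RX i j X)*(RX i j X) − (R i j)*(R i j)‖_tr ≤ 2κ_i²κ_j² [2log(2/δ)/m + √(2log(2/δ)/m)]`,
the trace norm of the self-adjoint difference `D` being `∑' k, ⟪e j k, S (e j k)⟫` where `S`
is the (unique) positive square root of `D* ∘ D`, i.e. `S = |D|`. -/

open MeasureTheory
open scoped RealInnerProductSpace

noncomputable section

theorem continuous_of_continuous_inner {T V : Type*} [TopologicalSpace T]
    [NormedAddCommGroup V] [InnerProductSpace ℝ V] {Φ : T → V}
    (h : Continuous fun p : T × T => ⟪Φ p.1, Φ p.2⟫) : Continuous Φ := by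
  rw [continuous_iff_continuousAt]
  intro t
  rw [ContinuousAt, tendsto_iff_norm_sub_tendsto_zero]
  have key : ∀ s, ‖Φ s - Φ t‖ = Real.sqrt (⟪Φ s, Φ s⟫ - 2 * ⟪Φ s, Φ t⟫ + ⟪Φ t, Φ t⟫) := by
    intro s
    rw [← Real.sqrt_sq (norm_nonneg (Φ s - Φ t)), norm_sub_sq_real, real_inner_self_eq_norm_sq,
      real_inner_self_eq_norm_sq]
  have h1 : Continuous fun s => ⟪Φ s, Φ s⟫ := h.comp (continuous_id.prodMk continuous_id)
  have h2 : Continuous fun s => ⟪Φ s, Φ t⟫ := h.comp (continuous_id.prodMk continuous_const)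
  have h3 : Continuous fun s => ‖Φ s - Φ t‖ := by
    simp_rw [key]
    fun_prop
  simpa using h3.tendsto t

/-- Convexity of `z ↦ cosh √z`. -/
theorem cosh_le_of_sq_eq_combination {u p q θ : ℝ} (h0 : 0 ≤ θ) (h1 : θ ≤ 1)
    (h : u ^ 2 = θ * p ^ 2 + (1 - θ) * q ^ 2) :
    Real.cosh u ≤ θ * Real.cosh p + (1 - θ) * Real.cosh q := by
  refine hasSum_le (fun n => ?_) (Real.hasSum_cosh u)
    (((Real.hasSum_cosh p).mul_left θ).add ((Real.hasSum_cosh q).mul_left (1 - θ)))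
  have hc := (convexOn_pow n).2 (sq_nonneg p : (0 : ℝ) ≤ p ^ 2) (sq_nonneg q : (0 : ℝ) ≤ q ^ 2)
    h0 (sub_nonneg.2 h1) (by ring)
  simp only [smul_eq_mul, ← h] at hc
  rw [pow_mul, pow_mul, pow_mul, ← mul_div_assoc, ← mul_div_assoc, ← add_div]
  gcongr

theorem cosh_norm_add_le {V : Type*} [NormedAddCommGroup V] [InnerProductSpace ℝ V] (a d : V) :
    Real.cosh ‖a + d‖ ≤ Real.cosh ‖a‖ * (Real.exp ‖d‖ - ‖d‖) +
      Real.sinh ‖a‖ / ‖a‖ * ⟪a, d⟫ := by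
  have hexp : Real.exp ‖d‖ = Real.cosh ‖d‖ + Real.sinh ‖d‖ := (Real.cosh_add_sinh _).symm
  have hs : ‖d‖ ≤ Real.sinh ‖d‖ := Real.self_le_sinh_iff.2 (norm_nonneg d)
  rcases eq_or_ne a 0 with rfl | ha
  · simp only [zero_add, norm_zero, Real.cosh_zero, one_mul, inner_zero_left, mul_zero, add_zero]
    linarith
  rcases eq_or_ne d 0 with rfl | hd
  · simp
  have hA : 0 < ‖a‖ := norm_pos_iff.2 ha
  have hD : 0 < ‖d‖ := norm_pos_iff.2 hd
  set A := ‖a‖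
  set D := ‖d‖
  obtain ⟨c, hc⟩ : ∃ c : ℝ, c * (A * D) = ⟪a, d⟫ :=
    ⟨⟪a, d⟫ / (A * D), div_mul_cancel₀ _ (by positivity)⟩
  have hAD : 0 < A * D := by positivity
  have habs := abs_le.1 (abs_real_inner_le_norm a d)
  change -(A * D) ≤ _ ∧ _ ≤ A * D at habs
  rw [← hc] at habs
  have hc1 : c ≤ 1 := by nlinarith [habs.2]
  have hc2 : -1 ≤ c := by nlinarith [habs.1]
  have hconv := cosh_le_of_sq_eq_combination (u := ‖a + d‖) (p := A + D) (q := A - D)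
    (θ := (1 + c) / 2) (by linarith) (by linarith) (by
      rw [norm_add_sq_real, ← hc]
      ring)
  rw [Real.cosh_add, Real.cosh_sub] at hconv
  have hlin : Real.sinh A / A * ⟪a, d⟫ = Real.sinh A * (c * D) := by
    rw [← hc]
    field_simp
  rw [hlin, hexp]
  have hsc : Real.sinh A ≤ Real.cosh A := (Real.sinh_lt_cosh A).le
  have hs0 : 0 ≤ Real.sinh A := Real.sinh_nonneg_iff.2 hA.le
  have hcs : c * Real.sinh A ≤ Real.cosh A := by nlinarith
  nlinarith [mul_nonneg (sub_nonneg.2 hcs) (sub_nonneg.2 hs)]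

theorem exp_sub_self_mul_le {y : ℝ} (h0 : 0 ≤ y) (h1 : y ≤ 1) :
    (Real.exp y - y) * (2 * (1 - y)) ≤ 2 * (1 - y) + y ^ 2 := by
  have h := Real.exp_bound' h0 h1 (n := 3) (by norm_num)
  norm_num [Finset.sum_range_succ, Nat.factorial] at h
  nlinarith [mul_nonneg (sub_nonneg.2 h) (sub_nonneg.2 h1), pow_nonneg h0 3, pow_nonneg h0 4]

section Concentration

variable {T V : Type*} [TopologicalSpace T] [SecondCountableTopology T] [MeasurableSpace T]
  [OpensMeasurableSpace T] [NormedAddCommGroup V] [InnerProductSpace ℝ V] [CompleteSpace V]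

theorem integrable_of_continuous_of_bounded {E : Type*} [NormedAddCommGroup E] (ν : Measure T)
    [IsFiniteMeasure ν] {f : T → E} (hf : Continuous f) (B : ℝ) (hB : ∀ t, ‖f t‖ ≤ B) :
    Integrable f ν :=
  Integrable.of_bound hf.stronglyMeasurable.aestronglyMeasurable B (ae_of_all _ hB)

theorem lintegral_cosh_norm_add_le (ν : Measure T) [IsProbabilityMeasure ν] {d : T → V}
    (hd : Continuous d) {B C : ℝ} (hB : ∀ t, ‖d t‖ ≤ B) (hmean : ∫ t, d t ∂ν = 0)
    (hC : ∫ t, (Real.exp ‖d t‖ - ‖d t‖) ∂ν ≤ C) (a : V) :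
    ∫⁻ t, ENNReal.ofReal (Real.cosh ‖a + d t‖) ∂ν ≤ ENNReal.ofReal (Real.cosh ‖a‖ * C) := by
  have hint : Integrable d ν := integrable_of_continuous_of_bounded ν hd B hB
  have hint1 : Integrable (fun t => Real.exp ‖d t‖ - ‖d t‖) ν := by
    refine Integrable.sub ?_ hint.norm
    refine integrable_of_continuous_of_bounded ν (by fun_prop) (Real.exp B) fun t => ?_
    rw [Real.norm_eq_abs, Real.abs_exp]
    exact Real.exp_le_exp.2 (hB t)
  have hint2 : Integrable (fun t => Real.sinh ‖a‖ / ‖a‖ * ⟪a, d t⟫) ν :=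
    (hint.const_inner a).const_mul _
  calc ∫⁻ t, ENNReal.ofReal (Real.cosh ‖a + d t‖) ∂ν
      ≤ ∫⁻ t, ENNReal.ofReal (Real.cosh ‖a‖ * (Real.exp ‖d t‖ - ‖d t‖) +
          Real.sinh ‖a‖ / ‖a‖ * ⟪a, d t⟫) ∂ν :=
        lintegral_mono fun t => ENNReal.ofReal_le_ofReal (cosh_norm_add_le a (d t))
    _ = ENNReal.ofReal (∫ t, (Real.cosh ‖a‖ * (Real.exp ‖d t‖ - ‖d t‖) +
          Real.sinh ‖a‖ / ‖a‖ * ⟪a, d t⟫) ∂ν) :=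
        (ofReal_integral_eq_lintegral_ofReal ((hint1.const_mul _).add hint2)
          (ae_of_all _ fun t => (Real.cosh_pos _).le.trans (cosh_norm_add_le a (d t)))).symm
    _ ≤ ENNReal.ofReal (Real.cosh ‖a‖ * C) := by
        refine ENNReal.ofReal_le_ofReal ?_
        rw [integral_add (hint1.const_mul _) hint2, integral_const_mul, integral_const_mul,
          integral_inner hint, hmean, inner_zero_right, mul_zero, add_zero]
        gcongr

theorem lintegral_cosh_norm_add_sum_le (ν : Measure T) [IsProbabilityMeasure ν] {d : T → V}
    (hd : Continuous d) {B C : ℝ} (hB : ∀ t, ‖d t‖ ≤ B) (hmean : ∫ t, d t ∂ν = 0)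
    (hC : ∫ t, (Real.exp ‖d t‖ - ‖d t‖) ∂ν ≤ C) (hC0 : 0 ≤ C) (m : ℕ) (a : V) :
    ∫⁻ X, ENNReal.ofReal (Real.cosh ‖a + ∑ k, d (X k)‖) ∂(Measure.pi fun _ : Fin m => ν) ≤
      ENNReal.ofReal (Real.cosh ‖a‖ * C ^ m) := by
  induction m generalizing a with
  | zero => simp
  | succ m ih =>
    have hmp := measurePreserving_piFinSuccAbove (fun _ : Fin (m + 1) => ν) 0
    have hmeas : Measurable fun p : T × (Fin m → T) =>
        ENNReal.ofReal (Real.cosh ‖a + d p.1 + ∑ k, d (p.2 k)‖) := by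
      refine ENNReal.measurable_ofReal.comp (Continuous.measurable ?_)
      fun_prop
    have hcomp := hmp.lintegral_comp hmeas
    have hsum : ∀ X : Fin (m + 1) → T,
        a + d (MeasurableEquiv.piFinSuccAbove (fun _ => T) 0 X).1 +
          ∑ k, d ((MeasurableEquiv.piFinSuccAbove (fun _ => T) 0 X).2 k) = a + ∑ k, d (X k) := by
      intro X
      rw [Fin.sum_univ_succ, add_assoc]
      rfl
    simp_rw [hsum] at hcomp
    rw [hcomp, lintegral_prod _ hmeas.aemeasurable]
    calc ∫⁻ t, ∫⁻ Y : Fin m → T, ENNReal.ofReal (Real.cosh ‖a + d t + ∑ k, d (Y k)‖)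
            ∂(Measure.pi fun _ : Fin m => ν) ∂ν
        ≤ ∫⁻ t, ENNReal.ofReal (Real.cosh ‖a + d t‖) * ENNReal.ofReal (C ^ m) ∂ν :=
          lintegral_mono fun t => (ih (a + d t)).trans_eq (ENNReal.ofReal_mul (Real.cosh_pos _).le)
      _ = (∫⁻ t, ENNReal.ofReal (Real.cosh ‖a + d t‖) ∂ν) * ENNReal.ofReal (C ^ m) :=
          lintegral_mul_const' _ _ ENNReal.ofReal_ne_top
      _ ≤ ENNReal.ofReal (Real.cosh ‖a‖ * C) * ENNReal.ofReal (C ^ m) := by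
          gcongr
          exact lintegral_cosh_norm_add_le ν hd hB hmean hC a
      _ = ENNReal.ofReal (Real.cosh ‖a‖ * C ^ (m + 1)) := by
          rw [← ENNReal.ofReal_mul (mul_nonneg (Real.cosh_pos _).le hC0)]
          ring_nf

theorem integral_norm_sub_integral_sq_le (ν : Measure T) [IsProbabilityMeasure ν] {ξ : T → V}
    (hξ : Continuous ξ) {M : ℝ} (hM : ∀ t, ‖ξ t‖ ≤ M) :
    ∫ t, ‖ξ t - ∫ s, ξ s ∂ν‖ ^ 2 ∂ν ≤ M ^ 2 := by
  have hint : Integrable ξ ν := integrable_of_continuous_of_bounded ν hξ M hM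
  set c := ∫ s, ξ s ∂ν with hc
  have hsq : ∀ t, ‖ξ t - c‖ ^ 2 ≤ M ^ 2 - 2 * ⟪c, ξ t⟫ + ‖c‖ ^ 2 := by
    intro t
    rw [norm_sub_sq_real, real_inner_comm]
    have := pow_le_pow_left₀ (norm_nonneg _) (hM t) 2
    linarith
  have hin : Integrable (fun t => M ^ 2 - 2 * ⟪c, ξ t⟫) ν :=
    (integrable_const _).sub ((hint.const_inner c).const_mul 2)
  calc ∫ t, ‖ξ t - c‖ ^ 2 ∂ν ≤ ∫ t, (M ^ 2 - 2 * ⟪c, ξ t⟫ + ‖c‖ ^ 2) ∂ν :=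
        integral_mono_of_nonneg (ae_of_all _ fun t => by positivity)
          (hin.add (integrable_const _)) (ae_of_all _ hsq)
    _ = M ^ 2 - ‖c‖ ^ 2 := by
        rw [integral_add hin (integrable_const _), integral_sub (integrable_const _)
          ((hint.const_inner c).const_mul 2), integral_const_mul, integral_inner hint, ← hc,
          real_inner_self_eq_norm_sq]
        simp
        ring
    _ ≤ M ^ 2 := by nlinarith [sq_nonneg ‖c‖]

/-- Bernstein inequality for bounded i.i.d. random vectors in a Hilbert space. -/
theorem ofReal_one_sub_le_pi_norm_mean_sub_integral_le (ν : Measure T) [IsProbabilityMeasure ν]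
    {ξ : T → V} (hξ : Continuous ξ) {M : ℝ} (hM0 : 0 < M) (hM : ∀ t, ‖ξ t‖ ≤ M) {m : ℕ}
    (hm : 0 < m) {δ : ℝ} (hδ0 : 0 < δ) (hδ1 : δ < 1) :
    ENNReal.ofReal (1 - δ) ≤ (Measure.pi fun _ : Fin m => ν) {X |
      ‖(m : ℝ)⁻¹ • ∑ k, ξ (X k) - ∫ t, ξ t ∂ν‖ ≤
        M * (2 * Real.log (2 / δ) / m + Real.sqrt (2 * Real.log (2 / δ) / m))} := by
  have hint : Integrable ξ ν := integrable_of_continuous_of_bounded ν hξ M hM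
  set c := ∫ s, ξ s ∂ν with hc
  set L := Real.log (2 / δ) with hLdef
  have hL : 0 < L := Real.log_pos (by rw [lt_div_iff₀ hδ0]; linarith)
  have hexpL : Real.exp (-L) = δ / 2 := by
    rw [Real.exp_neg, hLdef, Real.exp_log (by positivity), inv_div]
  have hm' : (0 : ℝ) < m := by exact_mod_cast hm
  set s := Real.sqrt (2 * L / m) with hs
  have hs0 : 0 < s := Real.sqrt_pos.2 (by positivity)
  have hs2 : s ^ 2 = 2 * L / m := Real.sq_sqrt (by positivity)
  have hLs : L = m * s ^ 2 / 2 := by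
    rw [hs2]
    field_simp
  obtain ⟨l, hl⟩ : ∃ l, l = s / (1 + 2 * s) := ⟨_, rfl⟩
  have hl0 : 0 < l := by rw [hl]; positivity
  have hl1 : 1 - 2 * l = (1 + 2 * s)⁻¹ := by
    rw [hl]
    field_simp
    ring
  have hl2 : 0 < 1 - 2 * l := by rw [hl1]; positivity
  set C := 1 + l ^ 2 / (2 * (1 - 2 * l)) with hCdef
  have hC0 : 0 ≤ C := by positivity
  have hcM : ‖c‖ ≤ M := by
    have := norm_integral_le_of_norm_le_const (μ := ν) (ae_of_all _ hM)
    simpa using this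
  have hB0 : ∀ t, ‖ξ t - c‖ ≤ 2 * M := fun t => by
    have := norm_sub_le (ξ t) c
    linarith [hM t]
  let d : T → V := fun t => (l / M) • (ξ t - c)
  have hd : Continuous d := by fun_prop
  have hdn : ∀ t, ‖d t‖ = l / M * ‖ξ t - c‖ := fun t => by
    rw [norm_smul, Real.norm_of_nonneg (by positivity)]
  have hB : ∀ t, ‖d t‖ ≤ 2 * l := fun t => by
    rw [hdn]
    calc l / M * ‖ξ t - c‖ ≤ l / M * (2 * M) := by gcongr; exact hB0 t
      _ = 2 * l := by field_simp
  have hmean : ∫ t, d t ∂ν = 0 := by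
    simp only [d]
    rw [integral_smul, integral_sub hint (integrable_const _)]
    simp [← hc]
  have hpt : ∀ t, Real.exp ‖d t‖ - ‖d t‖ ≤
      1 + l ^ 2 / M ^ 2 / (2 * (1 - 2 * l)) * ‖ξ t - c‖ ^ 2 := by
    intro t
    have h1 : ‖d t‖ ≤ 1 := (hB t).trans (by linarith)
    have h2 := exp_sub_self_mul_le (norm_nonneg (d t)) h1
    have h3 : 0 < 1 - ‖d t‖ := by linarith [hB t]
    have h4 : Real.exp ‖d t‖ - ‖d t‖ ≤ 1 + ‖d t‖ ^ 2 / (2 * (1 - ‖d t‖)) := by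
      rw [← sub_le_iff_le_add', le_div_iff₀ (by positivity)]
      linarith
    refine h4.trans (add_le_add_right ?_ _)
    calc ‖d t‖ ^ 2 / (2 * (1 - ‖d t‖)) ≤ ‖d t‖ ^ 2 / (2 * (1 - 2 * l)) := by
          gcongr
          exact hB t
      _ = l ^ 2 / M ^ 2 / (2 * (1 - 2 * l)) * ‖ξ t - c‖ ^ 2 := by
          rw [hdn]
          ring
  have hC : ∫ t, (Real.exp ‖d t‖ - ‖d t‖) ∂ν ≤ C := by
    have hi2 : Integrable (fun t => ‖ξ t - c‖ ^ 2) ν := by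
      refine integrable_of_continuous_of_bounded ν (by fun_prop) ((2 * M) ^ 2) fun t => ?_
      rw [norm_pow, norm_norm]
      exact pow_le_pow_left₀ (norm_nonneg _) (hB0 t) 2
    calc ∫ t, (Real.exp ‖d t‖ - ‖d t‖) ∂ν
        ≤ ∫ t, (1 + l ^ 2 / M ^ 2 / (2 * (1 - 2 * l)) * ‖ξ t - c‖ ^ 2) ∂ν := by
          refine integral_mono_of_nonneg (ae_of_all _ fun t => ?_)
            ((integrable_const _).add (hi2.const_mul _)) (ae_of_all _ hpt)
          have := Real.add_one_le_exp ‖d t‖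
          simp only [Pi.zero_apply]
          linarith
      _ = 1 + l ^ 2 / M ^ 2 / (2 * (1 - 2 * l)) * ∫ t, ‖ξ t - c‖ ^ 2 ∂ν := by
          rw [integral_add (integrable_const _) (hi2.const_mul _), integral_const_mul]
          simp
      _ ≤ 1 + l ^ 2 / M ^ 2 / (2 * (1 - 2 * l)) * M ^ 2 := by
          gcongr
          exact integral_norm_sub_integral_sq_le ν hξ hM
      _ = C := by
          rw [hCdef]
          field_simp
  have hmgf := lintegral_cosh_norm_add_sum_le ν hd hB hmean hC hC0 m 0
  simp only [zero_add, norm_zero, Real.cosh_zero, one_mul] at hmgf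
  set P := Measure.pi fun _ : Fin m => ν
  set good : Set (Fin m → T) := {X |
      ‖(m : ℝ)⁻¹ • ∑ k, ξ (X k) - c‖ ≤ M * (2 * L / m + s)} with hgood
  have hgm : MeasurableSet good :=
    (isClosed_le (by fun_prop) continuous_const).measurableSet
  set r := l * m * (2 * L / m + s) with hr
  have hr0 : 0 ≤ r := by positivity
  have hdsum : ∀ X : Fin m → T,
      ∑ k, d (X k) = (l / M * m) • ((m : ℝ)⁻¹ • ∑ k, ξ (X k) - c) := by
    intro X
    simp only [d]
    rw [← Finset.smul_sum, Finset.sum_sub_distrib, mul_smul, smul_sub (m : ℝ), smul_smul,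
      mul_inv_cancel₀ hm'.ne', one_smul]
    simp [Nat.cast_smul_eq_nsmul]
  have hsub : goodᶜ ⊆ {X | ENNReal.ofReal (Real.exp r / 2) ≤
      ENNReal.ofReal (Real.cosh ‖∑ k, d (X k)‖)} := by
    intro X hX
    have hX' : M * (2 * L / m + s) < ‖(m : ℝ)⁻¹ • ∑ k, ξ (X k) - c‖ := not_le.1 hX
    refine ENNReal.ofReal_le_ofReal ?_
    have h1 : r ≤ ‖∑ k, d (X k)‖ := by
      rw [hdsum, norm_smul, Real.norm_of_nonneg (by positivity)]
      calc r = l / M * m * (M * (2 * L / m + s)) := by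
            rw [hr]
            field_simp
        _ ≤ _ := by gcongr
    have h2 : Real.exp r ≤ Real.exp ‖∑ k, d (X k)‖ := Real.exp_le_exp.2 h1
    rw [Real.cosh_eq]
    have := Real.exp_pos (-‖∑ k, d (X k)‖)
    linarith
  have hCm : C ^ m ≤ Real.exp r / 2 * δ := by
    have h1 : C ≤ Real.exp (l ^ 2 / (2 * (1 - 2 * l))) := by
      rw [hCdef, add_comm]
      exact Real.add_one_le_exp _
    calc C ^ m ≤ Real.exp (l ^ 2 / (2 * (1 - 2 * l))) ^ m := pow_le_pow_left₀ hC0 h1 m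
      _ = Real.exp (r + -L) := by
          rw [← Real.exp_nat_mul, hl1, hr, ← hs2, hLs, hl]
          congr 1
          field_simp
          ring
      _ = Real.exp r / 2 * δ := by
          rw [Real.exp_add, hexpL]
          ring
  have hbad : P goodᶜ ≤ ENNReal.ofReal δ := by
    have hmark := mul_meas_ge_le_lintegral₀ (μ := P)
      (f := fun X => ENNReal.ofReal (Real.cosh ‖∑ k, d (X k)‖))
      (ENNReal.measurable_ofReal.comp (Continuous.measurable (by fun_prop))).aemeasurable
      (ENNReal.ofReal (Real.exp r / 2))
    have hpos : 0 < Real.exp r / 2 := by positivity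
    have h1 : ENNReal.ofReal (Real.exp r / 2) * P goodᶜ ≤
        ENNReal.ofReal (Real.exp r / 2) * ENNReal.ofReal δ := by
      rw [← ENNReal.ofReal_mul hpos.le]
      calc _ ≤ _ := mul_le_mul_right (measure_mono hsub) _
        _ ≤ _ := hmark
        _ ≤ _ := hmgf
        _ ≤ _ := ENNReal.ofReal_le_ofReal hCm
    exact (ENNReal.mul_le_mul_iff_right (ENNReal.ofReal_pos.2 hpos).ne'
      ENNReal.ofReal_ne_top).1 h1
  rw [ENNReal.ofReal_sub _ hδ0.le, ENNReal.ofReal_one]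
  rw [prob_compl_eq_one_sub hgm] at hbad
  exact tsub_le_iff_tsub_le.1 hbad

end Concentration

section HilbertSchmidt

variable {ι ι' F G : Type*} [NormedAddCommGroup F] [InnerProductSpace ℝ F]
  [NormedAddCommGroup G] [InnerProductSpace ℝ G]

theorem HilbertBasis.tsum_enorm_inner_sq (b : HilbertBasis ι ℝ F) (x : F) :
    ∑' k, ‖⟪b k, x⟫‖ₑ ^ 2 = ‖x‖ₑ ^ 2 := by
  have h := b.hasSum_inner_mul_inner x x
  have h1 : ∀ k, ⟪x, b k⟫ * ⟪b k, x⟫ = ⟪b k, x⟫ ^ 2 := fun k => by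
    rw [real_inner_comm, sq]
  simp_rw [h1, real_inner_self_eq_norm_sq] at h
  have h2 : ∀ k, ‖⟪b k, x⟫‖ₑ ^ 2 = ENNReal.ofReal (⟪b k, x⟫ ^ 2) := fun k => by
    rw [← ofReal_norm, ← ENNReal.ofReal_pow (norm_nonneg _), Real.norm_eq_abs, sq_abs]
  simp_rw [h2]
  rw [← ENNReal.ofReal_tsum_of_nonneg (fun k => sq_nonneg _) h.summable, h.tsum_eq,
    ENNReal.ofReal_pow (norm_nonneg _), ofReal_norm]

variable [CompleteSpace F] [CompleteSpace G]

theorem HilbertBasis.tsum_enorm_adjoint_sq (b : HilbertBasis ι ℝ F) (c : HilbertBasis ι' ℝ G)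
    (A : F →L[ℝ] G) : ∑' l, ‖A.adjoint (c l)‖ₑ ^ 2 = ∑' k, ‖A (b k)‖ₑ ^ 2 := by
  simp_rw [← b.tsum_enorm_inner_sq (A.adjoint _), ← c.tsum_enorm_inner_sq (A _)]
  rw [ENNReal.tsum_comm]
  congr! 6 with k l
  rw [ContinuousLinearMap.adjoint_inner_right, real_inner_comm]

theorem HilbertBasis.tsum_enorm_comp_contraction_sq_le (b : HilbertBasis ι ℝ F)
    (c : HilbertBasis ι' ℝ G) (A : F →L[ℝ] G) {V : F →L[ℝ] F} (hV : ‖V‖ ≤ 1) :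
    ∑' k, ‖A (V (b k))‖ₑ ^ 2 ≤ ∑' k, ‖A (b k)‖ₑ ^ 2 := by
  have h := b.tsum_enorm_adjoint_sq c (A ∘L V)
  simp only [ContinuousLinearMap.comp_apply] at h
  rw [← h, ← b.tsum_enorm_adjoint_sq c A]
  refine ENNReal.tsum_le_tsum fun l => ?_
  gcongr
  rw [ContinuousLinearMap.adjoint_comp, ContinuousLinearMap.comp_apply,
    ← ofReal_norm, ← ofReal_norm]
  refine ENNReal.ofReal_le_ofReal ((ContinuousLinearMap.le_opNorm _ _).trans ?_)
  rw [LinearIsometryEquiv.norm_map]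
  exact mul_le_of_le_one_left (norm_nonneg _) hV

theorem sum_norm_comp_contraction_sq_le (b : HilbertBasis ι ℝ F)
    (c : HilbertBasis ι' ℝ G) {A : F →L[ℝ] G} {a : ℝ}
    (hA : ∀ s : Finset ι, ∑ k ∈ s, ‖A (b k)‖ ^ 2 ≤ a ^ 2)
    {V : F →L[ℝ] F} (hV : ‖V‖ ≤ 1) (s : Finset ι) :
    ∑ k ∈ s, ‖A (V (b k))‖ ^ 2 ≤ a ^ 2 := by
  have conv : ∀ (f : ι → G) (s : Finset ι),
      ∑ k ∈ s, ‖f k‖ₑ ^ 2 = ENNReal.ofReal (∑ k ∈ s, ‖f k‖ ^ 2) := by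
    intro f s
    rw [ENNReal.ofReal_sum_of_nonneg fun k _ => by positivity]
    simp_rw [ENNReal.ofReal_pow (norm_nonneg _), ofReal_norm]
  rw [← ENNReal.ofReal_le_ofReal_iff (sq_nonneg a), ← conv fun k => A (V (b k))]
  refine (ENNReal.sum_le_tsum s).trans ((b.tsum_enorm_comp_contraction_sq_le c A hV).trans ?_)
  rw [ENNReal.tsum_eq_iSup_sum]
  refine iSup_le fun u => ?_
  rw [conv fun k => A (b k)]
  exact ENNReal.ofReal_le_ofReal (hA u)

/-- An approximate polar decomposition: if `S` is positive with `S² = D* D`, some contraction `V`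
satisfies `V* D ≈ S`. -/
theorem exists_contraction_inner_approx {S D : F →L[ℝ] F} (hS : S.IsPositive)
    (hSD : S ∘L S = D.adjoint ∘L D) {ε : ℝ} (hε : 0 < ε) :
    ∃ V : F →L[ℝ] F, ‖V‖ ≤ 1 ∧ ∀ x, ⟪x, S x⟫ ≤ ⟪V x, D x⟫ + ε * ‖x‖ ^ 2 := by
  let B : F →L[ℝ] F →L[ℝ] ℝ := (innerSL ℝ) ∘L (S + ε • ContinuousLinearMap.id ℝ F)
  have hBapply : ∀ v w, B v w = ⟪S v + ε • v, w⟫ := fun _ _ => rfl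
  have hB : IsCoercive B := by
    refine ⟨ε, hε, fun u => ?_⟩
    have := hS.inner_nonneg_left u
    rw [hBapply, inner_add_left, real_inner_smul_left, real_inner_self_eq_norm_sq]
    nlinarith
  let E := hB.continuousLinearEquivOfBilin
  have hE : ∀ v, E v = S v + ε • v := by
    intro v
    refine ext_inner_right ℝ fun w => ?_
    rw [IsCoercive.continuousLinearEquivOfBilin_apply, hBapply]
  have hSnorm : ∀ x, ‖D x‖ = ‖S x‖ := by
    intro x
    have h1 : ⟪S x, S x⟫ = ⟪D x, D x⟫ := by
      rw [hS.inner_left_eq_inner_right, ← ContinuousLinearMap.adjoint_inner_right]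
      exact congrArg (fun T : F →L[ℝ] F => ⟪x, T x⟫) hSD
    rw [real_inner_self_eq_norm_sq, real_inner_self_eq_norm_sq] at h1
    exact ((pow_left_inj₀ (norm_nonneg _) (norm_nonneg _) two_ne_zero).1 h1).symm
  have hSE : ∀ y, ‖S y‖ ≤ ‖E y‖ := by
    intro y
    rw [hE]
    refine le_of_sq_le_sq ?_ (norm_nonneg _)
    rw [norm_add_sq_real, real_inner_smul_right]
    have := hS.inner_nonneg_left y
    have : 0 ≤ 2 * (ε * ⟪S y, y⟫) := by positivity
    nlinarith [sq_nonneg ‖ε • y‖]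
  refine ⟨D ∘L (E.symm : F →L[ℝ] F), ?_, fun x => ?_⟩
  · refine ContinuousLinearMap.opNorm_le_bound _ zero_le_one fun x => ?_
    rw [ContinuousLinearMap.comp_apply, hSnorm, one_mul]
    exact (hSE _).trans_eq (by simp)
  · obtain ⟨y, rfl⟩ := E.surjective x
    have h1 : ⟪D y, D (E y)⟫ = ⟪S y, S (E y)⟫ := by
      rw [hS.inner_left_eq_inner_right, ← ContinuousLinearMap.adjoint_inner_right]
      exact (congrArg (fun T : F →L[ℝ] F => ⟪y, T (E y)⟫) hSD).symm
    have h2 : ⟪E y, S (E y)⟫ = ⟪S y, S (E y)⟫ + ε * ⟪y, S (E y)⟫ := by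
      conv_lhs => rw [hE y, inner_add_left, real_inner_smul_left, ← hE]
    have h3 : ⟪y, S (E y)⟫ ≤ ‖E y‖ ^ 2 := by
      rw [← hS.inner_left_eq_inner_right, sq]
      exact (real_inner_le_norm _ _).trans (mul_le_mul_of_nonneg_right (hSE y) (norm_nonneg _))
    simp only [ContinuousLinearMap.comp_apply, ContinuousLinearEquiv.coe_coe,
      ContinuousLinearEquiv.symm_apply_apply]
    rw [h2, h1]
    gcongr

theorem tsum_inner_abs_adjoint_comp_sub_le (b : HilbertBasis ι ℝ F)
    (c : HilbertBasis ι' ℝ G) {A B : F →L[ℝ] G} {α β η : ℝ} (hα : 0 ≤ α) (hβ : 0 ≤ β)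
    (hη : 0 ≤ η) (hA : ∀ s : Finset ι, ∑ k ∈ s, ‖A (b k)‖ ^ 2 ≤ α ^ 2)
    (hB : ∀ s : Finset ι, ∑ k ∈ s, ‖B (b k)‖ ^ 2 ≤ β ^ 2)
    (hAB : ∀ s : Finset ι, ∑ k ∈ s, ‖(A - B) (b k)‖ ^ 2 ≤ η ^ 2)
    {S : F →L[ℝ] F} (hS : S.IsPositive)
    (hSD : S ∘L S = (A.adjoint ∘L A - B.adjoint ∘L B).adjoint ∘L
      (A.adjoint ∘L A - B.adjoint ∘L B)) :
    ∑' k, ⟪b k, S (b k)⟫ ≤ (α + β) * η := by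
  have hcs : ∀ (s : Finset ι) (f g : ι → G) {p q : ℝ}, 0 ≤ p → 0 ≤ q →
      ∑ k ∈ s, ‖f k‖ ^ 2 ≤ p ^ 2 → ∑ k ∈ s, ‖g k‖ ^ 2 ≤ q ^ 2 →
      ∑ k ∈ s, ⟪f k, g k⟫ ≤ p * q := by
    intro s f g p q hp hq hf hg
    calc ∑ k ∈ s, ⟪f k, g k⟫ ≤ ∑ k ∈ s, ‖f k‖ * ‖g k‖ :=
          Finset.sum_le_sum fun k _ => real_inner_le_norm _ _
      _ ≤ Real.sqrt (∑ k ∈ s, ‖f k‖ ^ 2) * Real.sqrt (∑ k ∈ s, ‖g k‖ ^ 2) :=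
          Real.sum_mul_le_sqrt_mul_sqrt _ _ _
      _ ≤ p * q := by
          gcongr
          · exact Real.sqrt_le_iff.2 ⟨hp, hf⟩
          · exact Real.sqrt_le_iff.2 ⟨hq, hg⟩
  refine tsum_le_of_sum_le' (by positivity) fun s => ?_
  refine le_of_forall_pos_le_add fun ε hε => ?_
  obtain ⟨V, hV, hVD⟩ := exists_contraction_inner_approx hS hSD
    (ε := ε / (s.card + 1)) (by positivity)
  have hsplit : ∀ x, ⟪V x, (A.adjoint ∘L A - B.adjoint ∘L B) x⟫ =
      ⟪A (V x), (A - B) x⟫ + ⟪(A - B) (V x), B x⟫ := by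
    intro x
    simp only [_root_.sub_apply, ContinuousLinearMap.comp_apply, inner_sub_left,
      inner_sub_right, ContinuousLinearMap.adjoint_inner_right]
    ring
  calc ∑ k ∈ s, ⟪b k, S (b k)⟫
      ≤ ∑ k ∈ s, (⟪A (V (b k)), (A - B) (b k)⟫ + ⟪(A - B) (V (b k)), B (b k)⟫ +
          ε / (s.card + 1)) := by
        refine Finset.sum_le_sum fun k _ => ?_
        have := hVD (b k)
        rwa [hsplit, b.orthonormal.1 k, one_pow, mul_one] at this
    _ = ∑ k ∈ s, ⟪A (V (b k)), (A - B) (b k)⟫ + ∑ k ∈ s, ⟪(A - B) (V (b k)), B (b k)⟫ +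
          s.card * (ε / (s.card + 1)) := by
        rw [Finset.sum_add_distrib, Finset.sum_add_distrib, Finset.sum_const, nsmul_eq_mul]
    _ ≤ α * η + η * β + ε := by
        gcongr
        · exact hcs s _ _ hα hη (sum_norm_comp_contraction_sq_le b c hA hV s) (hAB s)
        · exact hcs s _ _ hη hβ (sum_norm_comp_contraction_sq_le b c hAB hV s) (hB s)
        · rw [mul_div_assoc', div_le_iff₀ (by positivity)]
          nlinarith
    _ = (α + β) * η + ε := by ring

end HilbertSchmidt

section RankOne

variable {ι F G : Type*} [NormedAddCommGroup F] [InnerProductSpace ℝ F]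
  [NormedAddCommGroup G] [InnerProductSpace ℝ G]

theorem lp.hasSum_norm_sq (v : lp (fun _ : ι => G) 2) :
    HasSum (fun k => ‖v k‖ ^ 2) (‖v‖ ^ 2) := by
  simpa only [real_inner_self_eq_norm_sq] using lp.hasSum_inner (𝕜 := ℝ) v v

theorem memℓp_inner_smul (b : HilbertBasis ι ℝ F) (x : F) (y : G) :
    Memℓp (fun k => ⟪x, b k⟫ • y) 2 := by
  refine memℓp_gen ?_
  have h := (b.summable_inner_mul_inner x x).mul_right (‖y‖ ^ 2)
  refine h.congr fun k => ?_
  rw [real_inner_comm (b k) x, ENNReal.toReal_ofNat, Real.rpow_two, norm_smul, mul_pow,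
    Real.norm_eq_abs, sq_abs]
  ring

/-- The Hilbert–Schmidt operator `f ↦ ⟪x, f⟫ • y`, as the family of its values on the Hilbert
basis `b`. -/
def rankOneHS (b : HilbertBasis ι ℝ F) (x : F) (y : G) : lp (fun _ : ι => G) 2 :=
  ⟨fun k => ⟪x, b k⟫ • y, memℓp_inner_smul b x y⟩

@[simp]
theorem rankOneHS_apply (b : HilbertBasis ι ℝ F) (x : F) (y : G) (k : ι) :
    rankOneHS b x y k = ⟪x, b k⟫ • y := rfl

theorem inner_rankOneHS (b : HilbertBasis ι ℝ F) (x x' : F) (y y' : G) :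
    ⟪rankOneHS b x y, rankOneHS b x' y'⟫ = ⟪x, x'⟫ * ⟪y, y'⟫ := by
  refine (lp.hasSum_inner (𝕜 := ℝ) (rankOneHS b x y) (rankOneHS b x' y')).unique ?_
  refine ((b.hasSum_inner_mul_inner x x').mul_right ⟪y, y'⟫).congr_fun fun k => ?_
  simp only [rankOneHS_apply, real_inner_smul_left, real_inner_smul_right]
  rw [real_inner_comm (b k) x']
  ring

theorem norm_rankOneHS (b : HilbertBasis ι ℝ F) (x : F) (y : G) :
    ‖rankOneHS b x y‖ = ‖x‖ * ‖y‖ := by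
  have h := inner_rankOneHS b x x y y
  simp only [real_inner_self_eq_norm_sq] at h
  rw [← mul_pow] at h
  exact (pow_left_inj₀ (norm_nonneg _) (by positivity) two_ne_zero).1 h

end RankOne

theorem empirical_cross_covariance_concentration_bounded
    {T : Type*} [MetricSpace T] [SigmaCompactSpace T] [MeasurableSpace T] [BorelSpace T]
    (ν : Measure T) [IsProbabilityMeasure ν]
    (K : Fin 2 → T → T → ℝ)
    (hKcont : ∀ i, Continuous fun p : T × T => K i p.1 p.2)
    (hKsymm : ∀ i s t, K i s t = K i t s)
    (hKpos : ∀ i (n : ℕ) (x : Fin n → T) (c : Fin n → ℝ),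
      0 ≤ ∑ a, ∑ b, c a * c b * K i (x a) (x b))
    (κ : Fin 2 → ℝ) (hκ : ∀ i, 0 < κ i)
    (hbound : ∀ i x, K i x x ≤ κ i ^ 2)
    (H : Fin 2 → Type*) [∀ i, NormedAddCommGroup (H i)] [∀ i, InnerProductSpace ℝ (H i)]
    [∀ i, CompleteSpace (H i)]
    (Φ : ∀ i, T → H i)
    (hΦ : ∀ i s t, ⟪Φ i s, Φ i t⟫ = K i s t)
    (hdense : ∀ i, (Submodule.span ℝ (Set.range (Φ i))).topologicalClosure = ⊤)
    (ι : Fin 2 → Type*) [∀ i, Countable (ι i)]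
    (e : ∀ i, HilbertBasis (ι i) ℝ (H i))
    (R : ∀ i j, H j →L[ℝ] H i)
    (hR : ∀ i j (f : H j), R i j f = ∫ t, ⟪Φ j t, f⟫ • Φ i t ∂ν)
    (m : ℕ) (hm : 0 < m)
    (RX : ∀ i j, (Fin m → T) → (H j →L[ℝ] H i))
    (hRX : ∀ i j (X : Fin m → T) (f : H j),
      RX i j X f = (m : ℝ)⁻¹ • ∑ k, ⟪Φ j (X k), f⟫ • Φ i (X k)) :
    (∀ i j (X : Fin m → T),
      Real.sqrt (∑' k, ‖RX i j X (e j k)‖ ^ 2) ≤ κ i * κ j) ∧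
    (∀ i j (δ : ℝ), 0 < δ → δ < 1 →
      ENNReal.ofReal (1 - δ) ≤
        (Measure.pi fun _ : Fin m => ν) {X : Fin m → T |
          Real.sqrt (∑' k, ‖(RX i j X - R i j) (e j k)‖ ^ 2) ≤
            κ i * κ j * (2 * Real.log (2 / δ) / m + Real.sqrt (2 * Real.log (2 / δ) / m)) ∧
          ∀ S : H j →L[ℝ] H j, S.IsPositive →
            S ∘L S =
              ((RX i j X).adjoint ∘L RX i j X - (R i j).adjoint ∘L R i j).adjoint ∘L
                ((RX i j X).adjoint ∘L RX i j X - (R i j).adjoint ∘L R i j) →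
            (∑' k, ⟪(e j k : H j), S (e j k)⟫) ≤
              2 * κ i ^ 2 * κ j ^ 2 *
                (2 * Real.log (2 / δ) / m + Real.sqrt (2 * Real.log (2 / δ) / m))}) := by
  have : SecondCountableTopology T := EMetric.secondCountable_of_sigmaCompact T
  have hΦnorm : ∀ i t, ‖Φ i t‖ ≤ κ i := by
    intro i t
    refine le_of_sq_le_sq ?_ (hκ i).le
    rw [← real_inner_self_eq_norm_sq, hΦ]
    exact hbound i t
  let ξ : ∀ i j, T → lp (fun _ : ι j => H i) 2 := fun i j t => rankOneHS (e j) (Φ j t) (Φ i t)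
  have hξcont : ∀ i j, Continuous (ξ i j) := by
    intro i j
    refine continuous_of_continuous_inner ?_
    simp only [ξ, inner_rankOneHS, hΦ]
    exact (hKcont j).mul (hKcont i)
  have hξnorm : ∀ i j t, ‖ξ i j t‖ ≤ κ i * κ j := by
    intro i j t
    rw [norm_rankOneHS, mul_comm]
    exact mul_le_mul (hΦnorm i t) (hΦnorm j t) (norm_nonneg _) (hκ i).le
  have hm' : (0 : ℝ) < m := by exact_mod_cast hm
  have heval : ∀ i j (v : lp (fun _ : ι j => H i) 2) k,
      v k = lp.evalCLM ℝ (fun _ : ι j => H i) 2 k v := fun _ _ _ _ => rfl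
  have hRX' : ∀ i j X k, ((m : ℝ)⁻¹ • ∑ l, ξ i j (X l) : lp (fun _ : ι j => H i) 2) k =
      RX i j X (e j k) := by
    intro i j X k
    rw [hRX, heval, map_smul, map_sum]
    rfl
  have hR' : ∀ i j k, (∫ t, ξ i j t ∂ν : lp (fun _ : ι j => H i) 2) k = R i j (e j k) := by
    intro i j k
    rw [hR, heval, ← ContinuousLinearMap.integral_comp_comm _
      (integrable_of_continuous_of_bounded ν (hξcont i j) _ (hξnorm i j))]
    rfl
  have hRXsum : ∀ i j X, HasSum (fun k => ‖RX i j X (e j k)‖ ^ 2)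
      (‖(m : ℝ)⁻¹ • ∑ l, ξ i j (X l)‖ ^ 2) := by
    intro i j X
    simpa only [hRX'] using lp.hasSum_norm_sq ((m : ℝ)⁻¹ • ∑ l, ξ i j (X l))
  have hRsum : ∀ i j, HasSum (fun k => ‖R i j (e j k)‖ ^ 2) (‖∫ t, ξ i j t ∂ν‖ ^ 2) := by
    intro i j
    simpa only [hR'] using lp.hasSum_norm_sq (∫ t, ξ i j t ∂ν)
  have hdiffsum : ∀ i j X, HasSum (fun k => ‖(RX i j X - R i j) (e j k)‖ ^ 2)
      (‖(m : ℝ)⁻¹ • ∑ l, ξ i j (X l) - ∫ t, ξ i j t ∂ν‖ ^ 2) := by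
    intro i j X
    simpa only [lp.coeFn_sub, Pi.sub_apply, hR', hRX', ← _root_.sub_apply] using
      lp.hasSum_norm_sq ((m : ℝ)⁻¹ • ∑ l, ξ i j (X l) - ∫ t, ξ i j t ∂ν)
  have hRXnorm : ∀ i j (X : Fin m → T), ‖(m : ℝ)⁻¹ • ∑ l, ξ i j (X l)‖ ≤ κ i * κ j := by
    intro i j X
    rw [norm_smul, Real.norm_of_nonneg (by positivity), inv_mul_le_iff₀ hm']
    refine (norm_sum_le _ _).trans ((Finset.sum_le_card_nsmul _ _ _
      fun l _ => hξnorm i j (X l)).trans_eq ?_)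
    simp
  have hRnorm : ∀ i j, ‖∫ t, ξ i j t ∂ν‖ ≤ κ i * κ j := by
    intro i j
    simpa using norm_integral_le_of_norm_le_const (μ := ν) (ae_of_all _ (hξnorm i j))
  refine ⟨fun i j X => ?_, fun i j δ hδ0 hδ1 => ?_⟩
  · rw [(hRXsum i j X).tsum_eq, Real.sqrt_sq (norm_nonneg _)]
    exact hRXnorm i j X
  · have hκκ : 0 < κ i * κ j := mul_pos (hκ i) (hκ j)
    refine (ofReal_one_sub_le_pi_norm_mean_sub_integral_le ν (hξcont i j) hκκ (hξnorm i j) hm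
      hδ0 hδ1).trans (measure_mono fun X hX => ⟨?_, fun S hS hSD => ?_⟩)
    · rw [(hdiffsum i j X).tsum_eq, Real.sqrt_sq (norm_nonneg _)]
      exact hX
    · have hfin : ∀ {f : ι j → ℝ} {a : ℝ}, HasSum (fun k => f k ^ 2) a →
          ∀ s : Finset (ι j), ∑ k ∈ s, f k ^ 2 ≤ a := fun h s =>
        sum_le_hasSum s (fun k _ => sq_nonneg _) h
      have htr := tsum_inner_abs_adjoint_comp_sub_le (e j) (e i) (norm_nonneg _) (norm_nonneg _)
        (norm_nonneg _) (hfin (hRXsum i j X)) (hfin (hRsum i j)) (hfin (hdiffsum i j X)) hS hSD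
      refine htr.trans ?_
      calc _ ≤ (κ i * κ j + κ i * κ j) * (κ i * κ j * (2 * Real.log (2 / δ) / m +
            Real.sqrt (2 * Real.log (2 / δ) / m))) :=
            mul_le_mul (add_le_add (hRXnorm i j X) (hRnorm i j)) hX (norm_nonneg _)
              (by positivity)
        _ = _ := by ring

end
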